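/- arXiv:2504.06494 — 4 statements merged into one kernel-verified Lean document; each statement's English description precedes it below -/
import Mathlib

section
/- Let u ∈ ℝ, λ̄ ≥ 0, and c ≥ 0, and suppose S_λ̄(|u|) = max(|u| − λ̄, 0) > c. Then w* = sign(u)·c is a minimizer over the set {w ∈ ℝ : |w| ≤ c} of the function w ↦ (1/2)(u − w)² + λ̄|w|. -/
/-- if the soft-thresholded magnitude `max (|u| - λ̄) 0` exceeds `c`,
then `sign u * c` minimizes `w ↦ (1/2)(u - w)² + λ̄|w|` over `{w : |w| ≤ c}`. -/
theorem clipped_softThreshold_is_constrained_minimizer_active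
    (u lamBar c : ℝ) (hlam : 0 ≤ lamBar) (hc : 0 ≤ c)
    (hactive : c < max (|u| - lamBar) 0) :
    |Real.sign u * c| ≤ c ∧
      ∀ w : ℝ, |w| ≤ c →
        (1 / 2) * (u - Real.sign u * c) ^ 2 + lamBar * |Real.sign u * c|
          ≤ (1 / 2) * (u - w) ^ 2 + lamBar * |w| := by
  have h : c < |u| - lamBar := by
    rcases lt_max_iff.1 hactive with h | h
    · exact h
    · linarith
  have key : ∀ w : ℝ, |w| ≤ c →
      (1 / 2) * (|u| - c) ^ 2 + lamBar * c ≤ (1 / 2) * (u - w) ^ 2 + lamBar * |w| := by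
    intro w hw
    have h1 : u * w ≤ |u| * |w| := by
      rw [← abs_mul]
      exact le_abs_self _
    have h2 := mul_nonneg (sub_nonneg.2 hw) (sub_nonneg.2 h.le)
    nlinarith [sq_nonneg (c - |w|), sq_abs u, sq_abs w]
  rcases lt_trichotomy u 0 with hu | hu | hu
  · have e : |Real.sign u * c| = c := by
      rw [Real.sign_of_neg hu, neg_one_mul, abs_neg, abs_of_nonneg hc]
    refine ⟨e.le, fun w hw => ?_⟩
    have k := key w hw
    rw [e, Real.sign_of_neg hu]
    rw [abs_of_neg hu] at k
    linarith
  · rw [hu, abs_zero] at h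
    linarith
  · have e : |Real.sign u * c| = c := by
      rw [Real.sign_of_pos hu, one_mul, abs_of_nonneg hc]
    refine ⟨e.le, fun w hw => ?_⟩
    have k := key w hw
    rw [e, Real.sign_of_pos hu]
    rw [abs_of_pos hu] at k
    linarith
end

section
/- Let u ∈ ℝ, λ̄ ≥ 0, and c ≥ 0. Then w* = sign(u)·min{c, max(|u| − λ̄, 0)} is the unique minimizer over the set {w ∈ ℝ : |w| ≤ c} of the function w ↦ (1/2)(u − w)² + λ̄|w|. -/
/-- Quadratic growth of the objective at the clipped soft-thresholded value. -/
lemma clipped_growth (u l c : ℝ) (hl : 0 ≤ l) (hc : 0 ≤ c) :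
    |Real.sign u * min c (max (|u| - l) 0)| ≤ c ∧ ∀ w : ℝ, |w| ≤ c →
      (1 / 2) * (u - Real.sign u * min c (max (|u| - l) 0)) ^ 2
          + l * |Real.sign u * min c (max (|u| - l) 0)|
          + (1 / 2) * (w - Real.sign u * min c (max (|u| - l) 0)) ^ 2
        ≤ (1 / 2) * (u - w) ^ 2 + l * |w| := by
  have hm0 : 0 ≤ min c (max (|u| - l) 0) := le_min hc (le_max_right _ _)
  have hmc : min c (max (|u| - l) 0) ≤ c := min_le_left _ _
  have hma : min c (max (|u| - l) 0) ≤ |u| :=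
    (min_le_right _ _).trans (max_le (by linarith) (abs_nonneg u))
  have key : ∀ w : ℝ, |w| ≤ c →
      0 ≤ (|u| - min c (max (|u| - l) 0) - l) * (min c (max (|u| - l) 0) - |w|) := by
    intro w hw
    have hw0 := abs_nonneg w
    rcases le_total (|u| - l) 0 with h | h
    · rw [max_eq_right h, min_eq_right hc]
      nlinarith
    · rw [max_eq_left h]
      rcases le_total c (|u| - l) with h2 | h2
      · rw [min_eq_left h2]
        exact mul_nonneg (by linarith) (by linarith)
      · rw [min_eq_right h2]
        apply le_of_eq
        ring
  generalize min c (max (|u| - l) 0) = m at *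
  rcases lt_trichotomy u 0 with hu | hu | hu
  · rw [Real.sign_of_neg hu]
    rw [abs_of_neg hu] at *
    rw [neg_one_mul, abs_neg, abs_of_nonneg hm0]
    refine ⟨hmc, fun w hw => ?_⟩
    nlinarith [key w hw, mul_nonneg (sub_nonneg.2 hma) (by linarith [neg_abs_le w] : 0 ≤ |w| + w)]
  · subst hu
    simp only [Real.sign_zero, zero_mul, abs_zero]
    refine ⟨hc, fun w hw => ?_⟩
    nlinarith [mul_nonneg hl (abs_nonneg w)]
  · rw [Real.sign_of_pos hu]
    rw [abs_of_pos hu] at *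
    rw [one_mul, abs_of_nonneg hm0]
    refine ⟨hmc, fun w hw => ?_⟩
    nlinarith [key w hw, mul_nonneg (sub_nonneg.2 hma) (by linarith [le_abs_self w] : 0 ≤ |w| - w)]

/-- `sign u * min c (max (|u| - λ̄) 0)` is the unique minimizer of
`w ↦ (1/2)(u - w)² + λ̄|w|` over `{w : |w| ≤ c}`. -/
theorem clipped_softThreshold_is_unique_constrained_minimizer
    (u lamBar c : ℝ) (hlam : 0 ≤ lamBar) (hc : 0 ≤ c) :
    (|Real.sign u * min c (max (|u| - lamBar) 0)| ≤ c ∧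
      ∀ w : ℝ, |w| ≤ c →
        (1 / 2) * (u - Real.sign u * min c (max (|u| - lamBar) 0)) ^ 2
            + lamBar * |Real.sign u * min c (max (|u| - lamBar) 0)|
          ≤ (1 / 2) * (u - w) ^ 2 + lamBar * |w|) ∧
      ∀ w : ℝ,
        (|w| ≤ c ∧
            ∀ w' : ℝ, |w'| ≤ c →
              (1 / 2) * (u - w) ^ 2 + lamBar * |w|
                ≤ (1 / 2) * (u - w') ^ 2 + lamBar * |w'|) →
          w = Real.sign u * min c (max (|u| - lamBar) 0) := by
  obtain ⟨h1, h2⟩ := clipped_growth u lamBar c hlam hc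
  refine ⟨⟨h1, fun w hw => ?_⟩, fun w ⟨hw, hmin⟩ => ?_⟩
  · have := h2 w hw
    have h3 := sq_nonneg (w - Real.sign u * min c (max (|u| - lamBar) 0))
    linarith
  · have h3 := h2 w hw
    have h4 := hmin _ h1
    have h5 : (w - Real.sign u * min c (max (|u| - lamBar) 0)) ^ 2 = 0 :=
      le_antisymm (by linarith) (sq_nonneg _)
    exact sub_eq_zero.1 (pow_eq_zero_iff two_ne_zero |>.1 h5)
end

section
/- Let K ≥ 1, U ∈ ℝ^K, λ̄ ≥ 0, and c ≥ 0. Define W* ∈ ℝ^K coordinatewise by W*_j = sign(U_j)·min{c, max(|U_j| − λ̄, 0)}. Then W* is the unique minimizer over the set {W ∈ ℝ^K : ‖W‖_∞ ≤ c} of the function W ↦ (1/2)‖U − W‖₂² + λ̄‖W‖₁, where ‖W‖₁ = Σ_j |W_j| and ‖W‖₂ is the Euclidean norm. -/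
/-- positive case of the scalar variational inequality -/
theorem scalar_pos_aux (u l c w : ℝ) (hu : 0 ≤ u) (hl : 0 ≤ l) (hc : 0 ≤ c) (hw : |w| ≤ c) :
    (u - min c (max (u - l) 0)) * (w - min c (max (u - l) 0))
      ≤ l * (|w| - min c (max (u - l) 0)) := by
  have h1 := le_abs_self w
  have h0 := abs_nonneg w
  rcases le_total (u - l) 0 with h | h
  · rw [max_eq_right h, min_eq_right hc]
    nlinarith [mul_nonneg hu (sub_nonneg.2 h1), mul_nonneg (sub_nonneg.2 h) h0]
  · rw [max_eq_left h]
    rcases le_total c (u - l) with h2 | h2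
    · rw [min_eq_left h2]
      nlinarith [mul_nonneg (sub_nonneg.2 h2) (sub_nonneg.2 (h1.trans hw)),
        mul_nonneg hl (sub_nonneg.2 h1)]
    · rw [min_eq_right h2]
      nlinarith [mul_nonneg hl (sub_nonneg.2 h1)]

theorem scalar_aux (u l c w s : ℝ) (hl : 0 ≤ l) (hc : 0 ≤ c) (hw : |w| ≤ c)
    (hs : s = Real.sign u * min c (max (|u| - l) 0)) :
    |s| ≤ c ∧ (1 / 2) * (u - s) ^ 2 + l * |s| + (1 / 2) * (w - s) ^ 2
      ≤ (1 / 2) * (u - w) ^ 2 + l * |w| := by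
  have hm0 : 0 ≤ min c (max (|u| - l) 0) := le_min hc (le_max_right _ _)
  have hmc : min c (max (|u| - l) 0) ≤ c := min_le_left _ _
  rcases lt_trichotomy u 0 with h | h | h
  · have key := scalar_pos_aux (-u) l c (-w) (by linarith) hl hc (by rwa [abs_neg])
    rw [Real.sign_of_neg h] at hs
    rw [abs_of_neg h] at hs hm0 hmc
    rw [abs_neg] at key
    generalize min c (max (-u - l) 0) = m at *
    have : |s| = m := by rw [hs, neg_one_mul, abs_neg, abs_of_nonneg hm0]
    rw [this]
    subst hs
    exact ⟨hmc, by nlinarith⟩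
  · subst h
    simp only [Real.sign_zero, zero_mul] at hs
    subst hs
    simp only [abs_zero]
    exact ⟨hc, by nlinarith [mul_nonneg hl (abs_nonneg w)]⟩
  · have key := scalar_pos_aux u l c w h.le hl hc hw
    rw [Real.sign_of_pos h] at hs
    rw [abs_of_pos h] at hs hm0 hmc
    generalize min c (max (u - l) 0) = m at *
    have : |s| = m := by rw [hs, one_mul, abs_of_nonneg hm0]
    rw [this]
    subst hs
    exact ⟨hmc, by nlinarith⟩

/-- coordinatewise soft-thresholding followed by clipping at `c` gives the
unique minimizer of `W ↦ (1/2)‖U − W‖₂² + λ̄‖W‖₁` over the ℓ∞ ball `{W : ‖W‖_∞ ≤ c}`. -/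
theorem clipped_softThreshold_vector_unique_minimizer
    (K : ℕ) (hK : 1 ≤ K) (U : Fin K → ℝ) (lamBar c : ℝ)
    (hlam : 0 ≤ lamBar) (hc : 0 ≤ c)
    (Wstar : Fin K → ℝ)
    (hWstar : ∀ j, Wstar j = Real.sign (U j) * min c (max (|U j| - lamBar) 0)) :
    ((∀ j, |Wstar j| ≤ c) ∧
      ∀ W : Fin K → ℝ, (∀ j, |W j| ≤ c) →
        (1 / 2) * (∑ j, (U j - Wstar j) ^ 2) + lamBar * (∑ j, |Wstar j|)
          ≤ (1 / 2) * (∑ j, (U j - W j) ^ 2) + lamBar * (∑ j, |W j|)) ∧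
      ∀ W : Fin K → ℝ,
        ((∀ j, |W j| ≤ c) ∧
            ∀ W' : Fin K → ℝ, (∀ j, |W' j| ≤ c) →
              (1 / 2) * (∑ j, (U j - W j) ^ 2) + lamBar * (∑ j, |W j|)
                ≤ (1 / 2) * (∑ j, (U j - W' j) ^ 2) + lamBar * (∑ j, |W' j|)) →
          W = Wstar := by
  have feas : ∀ j, |Wstar j| ≤ c := fun j =>
    (scalar_aux (U j) lamBar c 0 (Wstar j) hlam hc (by simpa using hc) (hWstar j)).1
  have key : ∀ W : Fin K → ℝ, (∀ j, |W j| ≤ c) →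
      (1 / 2) * (∑ j, (U j - Wstar j) ^ 2) + lamBar * (∑ j, |Wstar j|)
          + (1 / 2) * (∑ j, (W j - Wstar j) ^ 2)
        ≤ (1 / 2) * (∑ j, (U j - W j) ^ 2) + lamBar * (∑ j, |W j|) := by
    intro W hW
    simp only [Finset.mul_sum, ← Finset.sum_add_distrib]
    exact Finset.sum_le_sum fun j _ =>
      (scalar_aux (U j) lamBar c (W j) (Wstar j) hlam hc (hW j) (hWstar j)).2
  have nn : ∀ W : Fin K → ℝ, 0 ≤ ∑ j, (W j - Wstar j) ^ 2 := fun W =>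
    Finset.sum_nonneg fun j _ => sq_nonneg _
  refine ⟨⟨feas, fun W hW => by linarith [key W hW, nn W]⟩, ?_⟩
  rintro W ⟨hW, hmin⟩
  have h0 : ∑ j, (W j - Wstar j) ^ 2 = 0 :=
    le_antisymm (by linarith [key W hW, hmin Wstar feas]) (nn W)
  funext j
  have := (Finset.sum_eq_zero_iff_of_nonneg (fun j _ => sq_nonneg _)).1 h0 j (Finset.mem_univ j)
  exact sub_eq_zero.1 (pow_eq_zero_iff (two_ne_zero)|>.1 this)
end

section
/- Let K ≥ 1, L ≥ 1, v ∈ ℝ^K with v ≠ 0, U_1, …, U_L ∈ ℝ^K, and λ ≥ 0, λ̄ ≥ 0, τ ≥ 0. Suppose (b*, W*_1, …, W*_L) minimizes the function (b, W_1, …, W_L) ↦ (1/2)‖v − b‖₂² + λ‖b‖₂ + Σ_{l=1}^L [(1/2)‖U_l − W_l‖₂² + λ̄‖W_l‖₁] over the feasible set {(b, W_1, …, W_L) : ‖W_l‖_∞ ≤ τ‖b‖₂ for all l ∈ [L]}. For each l let T_l = {j ∈ [K] : max(|U_{l,j}| − λ̄, 0) > τ‖b*‖₂} and s_l = |T_l|,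 and set a = λ + λ̄·τ·(Σ_{l=1}^L s_l) − τ·Σ_{l=1}^L Σ_{j ∈ T_l} |U_{l,j}|. Then W*_{l,j} = sign(U_{l,j})·min{τ‖b*‖₂, max(|U_{l,j}| − λ̄, 0)} for every l and j, and b* = (1/(1 + τ²·Σ_{l=1}^L s_l))·max(1 − a/‖v‖₂, 0)·v. -/
open scoped RealInnerProductSpace

/-- Elementary facts on the clipped soft-threshold. -/
lemma clip_facts (u lb c : ℝ) (hlb : 0 ≤ lb) (hc : 0 ≤ c) :
    |Real.sign u * min c (max (|u| - lb) 0)| = min c (max (|u| - lb) 0) ∧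
    u * (Real.sign u * min c (max (|u| - lb) 0)) = |u| * min c (max (|u| - lb) 0) ∧
    0 ≤ min c (max (|u| - lb) 0) ∧ min c (max (|u| - lb) 0) ≤ |u| ∧
    (∀ w : ℝ, w * (u - Real.sign u * min c (max (|u| - lb) 0))
      ≤ |w| * (|u| - min c (max (|u| - lb) 0))) := by
  have h0 : 0 ≤ min c (max (|u| - lb) 0) := le_min hc (le_max_right _ _)
  have h1 : min c (max (|u| - lb) 0) ≤ |u| :=
    (min_le_right _ _).trans (max_le (by linarith) (abs_nonneg u))
  generalize min c (max (|u| - lb) 0) = p at *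
  rcases lt_trichotomy u 0 with hu | hu | hu
  · rw [Real.sign_of_neg hu]
    rw [abs_of_neg hu] at *
    refine ⟨by rw [abs_mul]; simp [abs_of_nonneg h0], by ring, h0, h1, fun w => ?_⟩
    nlinarith [neg_abs_le w]
  · subst hu
    simp at h1
    have : p = 0 := le_antisymm h1 h0
    subst this
    simp
  · rw [Real.sign_of_pos hu]
    rw [abs_of_pos hu] at *
    refine ⟨by rw [abs_mul]; simp [abs_of_nonneg h0], by ring, h0, h1, fun w => ?_⟩
    nlinarith [le_abs_self w]

lemma clip_opt (u lb c w : ℝ) (hlb : 0 ≤ lb) (hc : 0 ≤ c) (hw : |w| ≤ c) :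
    1 / 2 * (u - Real.sign u * min c (max (|u| - lb) 0)) ^ 2
      + lb * |Real.sign u * min c (max (|u| - lb) 0)|
      + 1 / 2 * (w - Real.sign u * min c (max (|u| - lb) 0)) ^ 2
      ≤ 1 / 2 * (u - w) ^ 2 + lb * |w| := by
  obtain ⟨h1, h2, h3, h4, h5⟩ := clip_facts u lb c hlb hc
  have h6 := h5 w
  have key : (|w| - min c (max (|u| - lb) 0)) * (|u| - min c (max (|u| - lb) 0) - lb) ≤ 0 := by
    have hw0 := abs_nonneg w
    rcases le_total c (max (|u| - lb) 0) with h | h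
    · rw [min_eq_left h]
      rcases le_total (|u| - lb) 0 with h' | h'
      · rw [max_eq_right h'] at h
        have : c = 0 := le_antisymm h hc
        have : |w| = 0 := by linarith
        rw [this, ‹c = 0›]; simp
      · rw [max_eq_left h'] at h
        nlinarith
    · rw [min_eq_right h]
      rcases le_total (|u| - lb) 0 with h' | h'
      · rw [max_eq_right h']
        nlinarith
      · rw [max_eq_left h']
        nlinarith
  have hsq : (Real.sign u * min c (max (|u| - lb) 0)) ^ 2 = (min c (max (|u| - lb) 0)) ^ 2 := by
    rw [← sq_abs, h1]
  rw [h1]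
  generalize Real.sign u * min c (max (|u| - lb) 0) = P at *
  generalize min c (max (|u| - lb) 0) = p at *
  nlinarith

lemma clip_descent (u lb c d : ℝ) (hlb : 0 ≤ lb) (hc : 0 ≤ c) (hd : 0 ≤ d) :
    1 / 2 * (u - Real.sign u * min d (max (|u| - lb) 0)) ^ 2
      + lb * |Real.sign u * min d (max (|u| - lb) 0)|
      ≤ 1 / 2 * (u - Real.sign u * min c (max (|u| - lb) 0)) ^ 2
      + lb * |Real.sign u * min c (max (|u| - lb) 0)|
      - max (max (|u| - lb) 0 - c) 0 * (d - c) + 1 / 2 * (d - c) ^ 2 := by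
  obtain ⟨h1, h2, -, -, -⟩ := clip_facts u lb c hlb hc
  obtain ⟨k1, k2, -, -, -⟩ := clip_facts u lb d hlb hd
  have hsq : (Real.sign u * min c (max (|u| - lb) 0)) ^ 2 = (min c (max (|u| - lb) 0)) ^ 2 := by
    rw [← sq_abs, h1]
  have ksq : (Real.sign u * min d (max (|u| - lb) 0)) ^ 2 = (min d (max (|u| - lb) 0)) ^ 2 := by
    rw [← sq_abs, k1]
  have key : 1 / 2 * (min d (max (|u| - lb) 0)) ^ 2 - (|u| - lb) * min d (max (|u| - lb) 0)
      ≤ 1 / 2 * (min c (max (|u| - lb) 0)) ^ 2 - (|u| - lb) * min c (max (|u| - lb) 0)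
      - max (max (|u| - lb) 0 - c) 0 * (d - c) + 1 / 2 * (d - c) ^ 2 := by
    generalize |u| - lb = x
    rcases le_total x 0 with h' | h'
    · rw [max_eq_right h', min_eq_right hc, min_eq_right hd, max_eq_right (by linarith)]
      nlinarith [sq_nonneg (d - c)]
    · rw [max_eq_left h']
      rcases le_total c x with hcx | hcx <;> rcases le_total d x with hdx | hdx
      · rw [min_eq_left hcx, min_eq_left hdx, max_eq_left (by linarith)]
        nlinarith
      · rw [min_eq_left hcx, min_eq_right hdx, max_eq_left (by linarith)]
        nlinarith [sq_nonneg (d - x)]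
      · rw [min_eq_right hcx, min_eq_left hdx, max_eq_right (by linarith)]
        nlinarith
      · rw [min_eq_right hcx, min_eq_right hdx, max_eq_right (by linarith)]
        nlinarith [sq_nonneg (d - c)]
  rw [h1, k1]
  generalize Real.sign u * min c (max (|u| - lb) 0) = P at *
  generalize Real.sign u * min d (max (|u| - lb) 0) = Q at *
  nlinarith

/-- First-order condition on the half line. -/
lemma first_order (r D C : ℝ) (hr : 0 ≤ r) (hC : 0 < C)
    (h : ∀ t : ℝ, 0 ≤ t → 0 ≤ D * (t - r) + C * (t - r) ^ 2) :
    0 ≤ D ∧ (0 < r → D = 0) := by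
  have hD : 0 ≤ D := by
    by_contra hD
    push Not at hD
    have hp : 0 < -D / (2 * C) := by apply div_pos <;> linarith
    have := h (r + -D / (2 * C)) (by linarith)
    have e : -D = 2 * C * (-D / (2 * C)) := by field_simp
    generalize -D / (2 * C) = q at *
    have e2 : D = -(2 * C * q) := by linarith
    subst e2
    nlinarith [mul_pos hC (mul_pos hp hp)]
  refine ⟨hD, fun hr0 => ?_⟩
  by_contra hne
  have hD' : 0 < D := lt_of_le_of_ne hD (Ne.symm hne)
  have hp : 0 < D / (2 * C) := by positivity
  have e : D = 2 * C * (D / (2 * C)) := by field_simp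
  generalize D / (2 * C) = q at *
  have hm : 0 < min r q := lt_min hr0 hp
  have := h (r - min r q) (by linarith [min_le_left r q])
  have hq := min_le_right r q
  generalize min r q = z at *
  subst e
  nlinarith [mul_pos hC (mul_pos hm hm), mul_nonneg hC.le (mul_nonneg hm.le (sub_nonneg.2 hq))]

/-- Theorem 1 of the paper: closed-form characterization of the joint
minimizer `(b*, W*_1, …, W*_L)` of the coupled problem
`(1/2)‖v − b‖₂² + λ‖b‖₂ + Σ_l [(1/2)‖U_l − W_l‖₂² + λ̄‖W_l‖₁]`
subject to `‖W_l‖_∞ ≤ τ‖b‖₂` for all `l`. -/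
theorem lassoRNet_proximal_step_closed_form
    (K L : ℕ) (hK : 1 ≤ K) (hL : 1 ≤ L)
    (v : EuclideanSpace ℝ (Fin K)) (hv : v ≠ 0)
    (U : Fin L → Fin K → ℝ)
    (lam lamBar τ : ℝ) (hlam : 0 ≤ lam) (hlamBar : 0 ≤ lamBar) (hτ : 0 ≤ τ)
    (bstar : EuclideanSpace ℝ (Fin K)) (Wstar : Fin L → Fin K → ℝ)
    (hfeas : ∀ l j, |Wstar l j| ≤ τ * ‖bstar‖)
    (hmin : ∀ (b : EuclideanSpace ℝ (Fin K)) (W : Fin L → Fin K → ℝ),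
      (∀ l j, |W l j| ≤ τ * ‖b‖) →
        (1 / 2) * ‖v - bstar‖ ^ 2 + lam * ‖bstar‖
            + ∑ l, ((1 / 2) * (∑ j, (U l j - Wstar l j) ^ 2)
                      + lamBar * (∑ j, |Wstar l j|))
          ≤ (1 / 2) * ‖v - b‖ ^ 2 + lam * ‖b‖
              + ∑ l, ((1 / 2) * (∑ j, (U l j - W l j) ^ 2)
                        + lamBar * (∑ j, |W l j|)))
    (s : Fin L → ℕ)
    (hs : ∀ l, s l =
      (Finset.filter (fun j => τ * ‖bstar‖ < max (|U l j| - lamBar) 0) Finset.univ).card)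
    (a : ℝ)
    (ha : a = lam + lamBar * τ * (∑ l, (s l : ℝ))
        - τ * ∑ l, ∑ j ∈ Finset.filter
            (fun j => τ * ‖bstar‖ < max (|U l j| - lamBar) 0) Finset.univ, |U l j|) :
    (∀ l j, Wstar l j
        = Real.sign (U l j) * min (τ * ‖bstar‖) (max (|U l j| - lamBar) 0)) ∧
      bstar = ((1 / (1 + τ ^ 2 * ∑ l, (s l : ℝ))) * max (1 - a / ‖v‖) 0) • v := by
  have hr : 0 ≤ ‖bstar‖ := norm_nonneg _
  have hv0 : 0 < ‖v‖ := norm_pos_iff.2 hv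
  set r := ‖bstar‖ with hrdef
  have hc : 0 ≤ τ * r := mul_nonneg hτ hr
  -- Step 1: the weights
  have hW : ∀ l j, Wstar l j
      = Real.sign (U l j) * min (τ * r) (max (|U l j| - lamBar) 0) := by
    have h1 := hmin bstar (fun l j => Real.sign (U l j) * min (τ * r) (max (|U l j| - lamBar) 0))
      (fun l j => by
        obtain ⟨h1, -⟩ := clip_facts (U l j) lamBar (τ * r) hlamBar hc
        rw [h1]; exact min_le_left _ _)
    have h2 : ∑ l, ∑ j, (1 / 2 * (U l j - Real.sign (U l j) * min (τ * r) (max (|U l j| - lamBar) 0)) ^ 2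
        + lamBar * |Real.sign (U l j) * min (τ * r) (max (|U l j| - lamBar) 0)|
        + 1 / 2 * (Wstar l j - Real.sign (U l j) * min (τ * r) (max (|U l j| - lamBar) 0)) ^ 2)
        ≤ ∑ l, ∑ j, (1 / 2 * (U l j - Wstar l j) ^ 2 + lamBar * |Wstar l j|) :=
      Finset.sum_le_sum fun l _ => Finset.sum_le_sum fun j _ =>
        clip_opt _ _ _ _ hlamBar hc (hfeas l j)
    simp only [Finset.mul_sum, Finset.sum_add_distrib] at h1 h2
    have h3 : ∑ l, ∑ j, 1 / 2 * (Wstar l j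
        - Real.sign (U l j) * min (τ * r) (max (|U l j| - lamBar) 0)) ^ 2 = 0 :=
      le_antisymm (by linarith)
        (Finset.sum_nonneg fun l _ => Finset.sum_nonneg fun j _ => by positivity)
    intro l j
    rw [Finset.sum_eq_zero_iff_of_nonneg
      (fun l _ => Finset.sum_nonneg fun j _ => by positivity)] at h3
    have h4 := h3 l (Finset.mem_univ _)
    rw [Finset.sum_eq_zero_iff_of_nonneg (fun j _ => by positivity)] at h4
    have h5 := h4 j (Finset.mem_univ _)
    have h6 : (Wstar l j - Real.sign (U l j) * min (τ * r) (max (|U l j| - lamBar) 0)) ^ 2 = 0 := by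
      linarith
    linarith [pow_eq_zero_iff (two_ne_zero) |>.1 h6]
  refine ⟨hW, ?_⟩
  have hnb : ∀ t : ℝ, 0 ≤ t → ‖(t / ‖v‖) • v‖ = t := by
    intro t ht
    rw [norm_smul, Real.norm_of_nonneg (by positivity)]
    field_simp
  have hnvb : ∀ t : ℝ, ‖v - (t / ‖v‖) • v‖ ^ 2 = (‖v‖ - t) ^ 2 := by
    intro t
    have : v - (t / ‖v‖) • v = (1 - t / ‖v‖) • v := by rw [sub_smul, one_smul]
    rw [this, norm_smul, mul_pow, Real.norm_eq_abs, sq_abs]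
    field_simp
  -- Step 2: the direction
  have hdir : bstar = (r / ‖v‖) • v := by
    have h1 := hmin ((r / ‖v‖) • v) Wstar (by rw [hnb r hr]; exact hfeas)
    rw [hnb r hr, hnvb, norm_sub_sq_real] at h1
    have h2 : ‖bstar - (r / ‖v‖) • v‖ ^ 2 ≤ 0 := by
      rw [norm_sub_sq_real, hnb r hr, inner_smul_right, real_inner_comm, ← hrdef]
      have h3 : r * ‖v‖ ≤ inner ℝ v bstar := by rw [← hrdef] at h1; nlinarith
      have h4 : r / ‖v‖ * (r * ‖v‖) ≤ r / ‖v‖ * inner ℝ v bstar :=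
        mul_le_mul_of_nonneg_left h3 (by positivity)
      have h5 : r / ‖v‖ * (r * ‖v‖) = r ^ 2 := by field_simp
      linarith
    have h3 : ‖bstar - (r / ‖v‖) • v‖ = 0 := by
      have := sq_nonneg ‖bstar - (r / ‖v‖) • v‖
      exact pow_eq_zero_iff (two_ne_zero) |>.1 (le_antisymm h2 this)
    exact sub_eq_zero.1 (norm_eq_zero.1 h3)
  -- Step 3: the length
  have hfo := first_order r
    (r - ‖v‖ + lam - τ * ∑ l, ∑ j, max (max (|U l j| - lamBar) 0 - τ * r) 0)
    (1 / 2 + ∑ _l : Fin L, ∑ _j : Fin K, 1 / 2 * τ ^ 2) hr (by positivity) (by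
      intro t ht
      have hd : 0 ≤ τ * t := mul_nonneg hτ ht
      have h1 := hmin ((t / ‖v‖) • v)
        (fun l j => Real.sign (U l j) * min (τ * t) (max (|U l j| - lamBar) 0))
        (fun l j => by
          obtain ⟨h1, -⟩ := clip_facts (U l j) lamBar (τ * t) hlamBar hd
          rw [h1, hnb t ht]; exact min_le_left _ _)
      have h0 : ‖v - bstar‖ ^ 2 = (‖v‖ - r) ^ 2 := by
        conv_lhs => rw [hdir]
        exact hnvb r
      rw [hnb t ht, hnvb, h0] at h1
      have h2 : ∑ l, ∑ j, (1 / 2 * (U l j - Real.sign (U l j) * min (τ * t) (max (|U l j| - lamBar) 0)) ^ 2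
          + lamBar * |Real.sign (U l j) * min (τ * t) (max (|U l j| - lamBar) 0)|)
          ≤ ∑ l, ∑ j, (1 / 2 * (U l j - Wstar l j) ^ 2 + lamBar * |Wstar l j|
            - τ * (t - r) * max (max (|U l j| - lamBar) 0 - τ * r) 0
            + (t - r) ^ 2 * (1 / 2 * τ ^ 2)) :=
        Finset.sum_le_sum fun l _ => Finset.sum_le_sum fun j _ => by
          have := clip_descent (U l j) lamBar (τ * r) (τ * t) hlamBar hc hd
          rw [← hW l j] at this
          linarith
      simp only [Finset.sum_add_distrib, Finset.sum_sub_distrib, ← Finset.mul_sum] at h1 h2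
      simp only [← Finset.mul_sum]
      nlinarith)
  have hD : r - ‖v‖ + lam - τ * ∑ l, ∑ j, max (max (|U l j| - lamBar) 0 - τ * r) 0
      = (1 + τ ^ 2 * ∑ l, (s l : ℝ)) * r - ‖v‖ + a := by
    have h1 : ∀ l, ∑ j, max (max (|U l j| - lamBar) 0 - τ * r) 0
        = (∑ j ∈ Finset.filter
            (fun j => τ * r < max (|U l j| - lamBar) 0) Finset.univ, |U l j|)
          - (lamBar + τ * r) * (s l : ℝ) := by
      intro l
      have h2 : (lamBar + τ * r) * (s l : ℝ) = ∑ j ∈ Finset.filter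
            (fun j => τ * r < max (|U l j| - lamBar) 0) Finset.univ, (lamBar + τ * r) := by
        rw [Finset.sum_const, hs l, nsmul_eq_mul, mul_comm]
      rw [h2, ← Finset.sum_sub_distrib, Finset.sum_filter]
      refine Finset.sum_congr rfl fun j _ => ?_
      split_ifs with h
      · rw [max_eq_left (by linarith)]
        rcases le_total (|U l j| - lamBar) 0 with h' | h'
        · rw [max_eq_right h'] at h; linarith
        · rw [max_eq_left h']; ring
      · rw [max_eq_right (by linarith)]
    simp only [h1, Finset.sum_sub_distrib, ← Finset.mul_sum]
    rw [ha]
    ring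
  rw [hD] at hfo
  have hS : 0 < 1 + τ ^ 2 * ∑ l, (s l : ℝ) := by positivity
  rw [hdir]
  congr 1
  generalize 1 + τ ^ 2 * ∑ l, (s l : ℝ) = M at *
  rcases hr.eq_or_lt with h0 | h0
  · rw [← h0] at hfo ⊢
    have : 1 ≤ a / ‖v‖ := by rw [le_div_iff₀ hv0]; linarith [hfo.1]
    rw [max_eq_right (by linarith)]
    simp
  · have h := hfo.2 h0
    have ha' : a = ‖v‖ - M * r := by linarith
    have e : 1 - a / ‖v‖ = M * r / ‖v‖ := by rw [ha']; field_simp; ring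
    rw [e, max_eq_left (by positivity)]
    field_simp
end
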